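/- Let 1 ≤ p < ∞. If b = (b_n)_{n≥0} is a complex sequence with ∑_{n=0}^∞ sup_{k≥n} |b_k| < ∞ (that is, b ∈ d₁), then b is a multiplier of d_p: a*b ∈ d_p for every a ∈ d_p. -/

import Mathlib

open scoped ENNReal NNReal BigOperators

/-- The `p`-th power sum defining the `d_p` (quasi-)norm:
`∑_{n} sup_{k ≥ n} |a_k|^p`, valued in `ℝ≥0∞`. -/
noncomputable def dpSum (p : ℝ) (a : ℕ → ℂ) : ℝ≥0∞ :=
  ∑' n : ℕ, ⨆ k ∈ Set.Ici n, (‖a k‖₊ : ℝ≥0∞) ^ p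

/-- The `d_p` norm `(∑_{n} sup_{k ≥ n} |a_k|^p)^{1/p}`, valued in `ℝ≥0∞`. -/
noncomputable def dpNorm (p : ℝ) (a : ℕ → ℂ) : ℝ≥0∞ := dpSum p a ^ (1 / p)

/-- Membership in the sequence space `d_p`. -/
def MemDp (p : ℝ) (a : ℕ → ℂ) : Prop := dpSum p a ≠ ⊤

/-- Convolution of sequences: `(a*b)_n = ∑_{j=0}^n a_j b_{n-j}`. -/
noncomputable def conv (a b : ℕ → ℂ) : ℕ → ℂ :=
  fun n => ∑ j ∈ Finset.range (n + 1), a j * b (n - j)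

/-- `b` is a multiplier of `d_p` if `a * b ∈ d_p` for every `a ∈ d_p`. -/
def IsMultiplier (p : ℝ) (b : ℕ → ℂ) : Prop :=
  ∀ a : ℕ → ℂ, MemDp p a → MemDp p (conv a b)

/-- The canonical sequence `e m` with a `1` in position `m` and `0` elsewhere. -/
def e (m : ℕ) : ℕ → ℂ := fun n => if n = m then 1 else 0

/-- The right shift `S a = (0, a₀, a₁, …)`. -/
def shift (a : ℕ → ℂ) : ℕ → ℂ := fun n => match n with
  | 0 => 0
  | Nat.succ k => a k


/-- The least antitone majorant of a sequence in `ℝ≥0∞`. -/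
noncomputable def tailSup (f : ℕ → ℝ≥0∞) (n : ℕ) : ℝ≥0∞ := ⨆ k ∈ Set.Ici n, f k

theorem le_tailSup (f : ℕ → ℝ≥0∞) {n k : ℕ} (h : n ≤ k) : f k ≤ tailSup f n :=
  le_iSup₂_of_le k h le_rfl

theorem tailSup_antitone (f : ℕ → ℝ≥0∞) : Antitone (tailSup f) :=
  fun _ _ h => iSup₂_le fun _ hk => le_tailSup f (h.trans hk)

theorem tsum_div_two (f : ℕ → ℝ≥0∞) : ∑' n : ℕ, f (n / 2) = 2 * ∑' n, f n := by
  rw [← tsum_even_add_odd (f := fun n => f (n / 2)) ENNReal.summable ENNReal.summable, two_mul]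
  congr 1
  · simp
  · refine tsum_congr fun n => congrArg f ?_
    omega

/-- The reversed finite sums of a sequence are bounded by its total sum. -/
theorem sum_range_sub_le_tsum (f : ℕ → ℝ≥0∞) (m : ℕ) :
    ∑ j ∈ Finset.range (m + 1), f (m - j) ≤ ∑' n, f n := by
  rw [← Finset.sum_range_reflect]
  refine le_trans (Finset.sum_le_sum fun j hj => ?_) (ENNReal.sum_le_tsum (Finset.range (m + 1)))
  have := Finset.mem_range.1 hj
  exact le_of_eq (congrArg f (by omega))

/-- Splitting a convolution in the middle. -/
theorem sum_mul_le_of_antitone {f g : ℕ → ℝ≥0∞} (hf : Antitone f) (hg : Antitone g) (m : ℕ) :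
    ∑ j ∈ Finset.range (m + 1), g (m - j) * f j
      ≤ (∑' n, g n) * f (m / 2) + g (m / 2) * ∑' n, f n := by
  calc ∑ j ∈ Finset.range (m + 1), g (m - j) * f j
      ≤ ∑ j ∈ Finset.range (m + 1), (g (m - j) * f (m / 2) + g (m / 2) * f j) := by
        refine Finset.sum_le_sum fun j _ => ?_
        rcases le_total (m / 2) j with h | h
        · exact le_add_right (mul_le_mul_right (hf h) _)
        · exact le_add_left (mul_le_mul_left (hg (by omega)) _)
    _ ≤ _ := by
        rw [Finset.sum_add_distrib, ← Finset.sum_mul, ← Finset.mul_sum]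
        gcongr
        · exact sum_range_sub_le_tsum g m
        · exact ENNReal.sum_le_tsum _

/-- Jensen's inequality for the weighted sum defining a convolution. -/
theorem nnnorm_conv_rpow_le {p : ℝ} (hp : 1 ≤ p) (a b : ℕ → ℂ) {f g : ℕ → ℝ≥0∞}
    (hf : ∀ n, (‖a n‖₊ : ℝ≥0∞) ^ p ≤ f n) (hg : ∀ n, (‖b n‖₊ : ℝ≥0∞) ≤ g n) (m : ℕ) :
    (‖conv a b m‖₊ : ℝ≥0∞) ^ p
      ≤ (∑' n, g n) ^ (p - 1) * ∑ j ∈ Finset.range (m + 1), g (m - j) * f j := by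
  have hp0 : 0 < p := by linarith
  have hnorm : (‖conv a b m‖₊ : ℝ≥0∞)
      ≤ ∑ j ∈ Finset.range (m + 1), g (m - j) * (‖a j‖₊ : ℝ≥0∞) := by
    calc (‖conv a b m‖₊ : ℝ≥0∞)
        ≤ ((∑ j ∈ Finset.range (m + 1), ‖a j * b (m - j)‖₊ : ℝ≥0) : ℝ≥0∞) :=
          ENNReal.coe_le_coe.2 (nnnorm_sum_le _ _)
      _ ≤ _ := by
          rw [ENNReal.ofNNReal_finsetSum]
          refine Finset.sum_le_sum fun j _ => ?_
          rw [nnnorm_mul, ENNReal.coe_mul, mul_comm]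
          gcongr
          exact hg _
  have hhold := hnorm.trans (ENNReal.inner_le_weight_mul_Lp_of_nonneg (Finset.range (m + 1)) hp
    (fun j => g (m - j)) (fun j => (‖a j‖₊ : ℝ≥0∞)))
  refine (ENNReal.rpow_le_rpow hhold hp0.le).trans ?_
  rw [ENNReal.mul_rpow_of_nonneg _ _ hp0.le, ← ENNReal.rpow_mul, ← ENNReal.rpow_mul,
    inv_mul_cancel₀ hp0.ne', ENNReal.rpow_one, sub_mul, inv_mul_cancel₀ hp0.ne', one_mul]
  gcongr
  · exact sum_range_sub_le_tsum g m
  · exact hf _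

/-- every `b ∈ d₁` is a multiplier of `d_p`, `1 ≤ p < ∞`. -/
theorem dOne_subset_multipliers (p : ℝ) (hp : 1 ≤ p) (b : ℕ → ℂ) (hb : MemDp 1 b) :
    IsMultiplier p b := by
  intro a ha
  set f := tailSup fun k => (‖a k‖₊ : ℝ≥0∞) ^ p
  set g := tailSup fun k => (‖b k‖₊ : ℝ≥0∞) ^ (1 : ℝ)
  have hfs : ∑' n, f n ≠ ⊤ := ha
  have hgs : ∑' n, g n ≠ ⊤ := hb
  have hfa : Antitone f := tailSup_antitone _
  have hga : Antitone g := tailSup_antitone _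
  set K := (∑' n, g n) ^ (p - 1)
  set F : ℕ → ℝ≥0∞ := fun n => K * ((∑' n, g n) * f n + g n * ∑' n, f n) with hF
  have hbound : ∀ n, ⨆ k ∈ Set.Ici n, (‖conv a b k‖₊ : ℝ≥0∞) ^ p ≤ F (n / 2) := by
    refine fun n => iSup₂_le fun m hm => ?_
    have hnm : n / 2 ≤ m / 2 := Nat.div_le_div_right hm
    refine (nnnorm_conv_rpow_le hp a b (f := f) (g := g) (fun n => le_tailSup _ le_rfl)
      (fun n => ?_) m).trans ?_
    · exact (ENNReal.rpow_one _).ge.trans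
        (le_tailSup (fun k => (‖b k‖₊ : ℝ≥0∞) ^ (1 : ℝ)) (le_refl n))
    · refine mul_le_mul_right ((sum_mul_le_of_antitone hfa hga m).trans ?_) _
      gcongr
      · exact hfa hnm
      · exact hga hnm
  refine ne_top_of_le_ne_top ?_ ((ENNReal.tsum_le_tsum hbound).trans_eq (tsum_div_two F))
  rw [hF, ENNReal.tsum_mul_left, ENNReal.tsum_add, ENNReal.tsum_mul_left, ENNReal.tsum_mul_right]
  have hK : K ≠ ⊤ := ENNReal.rpow_ne_top_of_nonneg (by linarith) hgs
  finiteness
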